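/- arXiv:1704.04009 — 2 statements merged into one kernel-verified Lean document; each statement's English description precedes it below -/
import Mathlib

section
/- Let A be a real n×n matrix and M a symmetric positive definite real n×n matrix satisfying the strict Lyapunov inequality Aᵀ M + M A ≺ 0 (negative definite). Let Φ be a real n×k matrix of full column rank, set N = Φᵀ M Φ (which is symmetric positive definite), and let Ψ = M Φ N⁻¹. Then the reduced matrix Ã = Ψᵀ A Φ satisfies Ãᵀ N + N Ã ≺ 0; in particular, Ã is Hurwitz (every eigenvalue of Ã has strictly negative real part). -/
open Matrix

/-- A real square matrix is Hurwitz if every eigenvalue of it, viewed as a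
complex matrix, has strictly negative real part. -/
def IsHurwitz {k : ℕ} (A : Matrix (Fin k) (Fin k) ℝ) : Prop :=
  ∀ μ ∈ spectrum ℂ (A.map (Complex.ofReal)), μ.re < 0

/-- A real matrix satisfying a strict Lyapunov inequality is Hurwitz. -/
theorem IsHurwitz.of_lyapunov {k : ℕ} {B P : Matrix (Fin k) (Fin k) ℝ} (hP : P.PosDef)
    (hL : (-(Bᵀ * P + P * B)).PosDef) : IsHurwitz B := by
  intro μ hμ
  rw [← Matrix.spectrum_toLin', ← Module.End.hasEigenvalue_iff_mem_spectrum] at hμ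
  obtain ⟨v, hv⟩ := hμ.exists_hasEigenvector
  have hBv : B.map Complex.ofReal *ᵥ v = μ • v := by simpa using hv.apply_eq_smul
  set x : Fin k → ℝ := fun i => (v i).re with hx
  set y : Fin k → ℝ := fun i => (v i).im with hy
  have hBx : B *ᵥ x = μ.re • x - μ.im • y := by
    ext i
    simpa [mulVec, dotProduct, hx, hy] using congrArg Complex.re (congrFun hBv i)
  have hBy : B *ᵥ y = μ.re • y + μ.im • x := by
    ext i
    simpa [mulVec, dotProduct, hx, hy] using congrArg Complex.im (congrFun hBv i)
  have hPT : Pᵀ = P := by simpa using hP.isHermitian.eq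
  have hsymm (u w : Fin k → ℝ) : u ⬝ᵥ P *ᵥ w = w ⬝ᵥ P *ᵥ u := by
    rw [dotProduct_mulVec, ← mulVec_transpose, hPT, dotProduct_comm]
  have hform (u : Fin k → ℝ) :
      u ⬝ᵥ (-(Bᵀ * P + P * B)) *ᵥ u = -2 * (u ⬝ᵥ P *ᵥ (B *ᵥ u)) := by
    have h : u ⬝ᵥ Bᵀ *ᵥ (P *ᵥ u) = u ⬝ᵥ P *ᵥ (B *ᵥ u) := by
      rw [dotProduct_mulVec, vecMul_transpose, hsymm]
    rw [neg_mulVec, add_mulVec, dotProduct_neg, dotProduct_add, ← mulVec_mulVec,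
      ← mulVec_mulVec, h]
    ring
  have hsum : x ⬝ᵥ P *ᵥ (B *ᵥ x) + y ⬝ᵥ P *ᵥ (B *ᵥ y) =
      μ.re * (x ⬝ᵥ P *ᵥ x + y ⬝ᵥ P *ᵥ y) := by
    rw [hBx, hBy]
    simp only [mulVec_sub, mulVec_add, mulVec_smul, dotProduct_sub, dotProduct_add,
      dotProduct_smul, smul_eq_mul]
    rw [hsymm y x]
    ring
  have hxy : x ≠ 0 ∨ y ≠ 0 := by
    by_contra! h
    exact hv.2 (funext fun i => Complex.ext (congrFun h.1 i) (congrFun h.2 i))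
  have hnonneg {Q : Matrix (Fin k) (Fin k) ℝ} (hQ : Q.PosDef) (u : Fin k → ℝ) :
      0 ≤ u ⬝ᵥ Q *ᵥ u := by
    simpa using hQ.posSemidef.dotProduct_mulVec_nonneg u
  have hpos {Q : Matrix (Fin k) (Fin k) ℝ} (hQ : Q.PosDef) :
      0 < x ⬝ᵥ Q *ᵥ x + y ⬝ᵥ Q *ᵥ y := by
    rcases hxy with h | h
    · exact add_pos_of_pos_of_nonneg (by simpa using hQ.dotProduct_mulVec_pos h) (hnonneg hQ y)
    · exact add_pos_of_nonneg_of_pos (hnonneg hQ x) (by simpa using hQ.dotProduct_mulVec_pos h)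
  have h₁ := hpos hP
  have h₂ := hpos hL
  rw [hform, hform] at h₂
  by_contra! hre
  nlinarith [mul_nonneg hre h₁.le]

/-- A matrix of full column rank acts injectively on column vectors. -/
theorem Matrix.mulVec_injective_of_rank_eq {n k : ℕ} {Φ : Matrix (Fin n) (Fin k) ℝ}
    (hΦ : Φ.rank = k) : Function.Injective Φ.mulVec := by
  rw [mulVec_injective_iff, linearIndependent_iff_card_eq_finrank_span, Set.finrank,
    ← rank_eq_finrank_span_cols, hΦ, Fintype.card_fin]

theorem innerProduct_projection_preserves_strict_lyapunov
    {n k : ℕ} (A M : Matrix (Fin n) (Fin n) ℝ) (Φ : Matrix (Fin n) (Fin k) ℝ)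
    (hM : M.PosDef)
    (hLyap : (-(Aᵀ * M + M * A)).PosDef)
    (hΦ : Φ.rank = k)
    (N : Matrix (Fin k) (Fin k) ℝ) (hN : N = Φᵀ * M * Φ)
    (Ψ : Matrix (Fin n) (Fin k) ℝ) (hΨ : Ψ = M * Φ * N⁻¹)
    (Ared : Matrix (Fin k) (Fin k) ℝ) (hAred : Ared = Ψᵀ * A * Φ) :
    (-(Aredᵀ * N + N * Ared)).PosDef ∧ IsHurwitz Ared := by
  have hinj := mulVec_injective_of_rank_eq hΦ
  have hNpos : N.PosDef := by
    simpa [hN] using hM.conjTranspose_mul_mul_same hinj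
  have hMT : Mᵀ = M := by simpa using hM.isHermitian.eq
  have hNT : Nᵀ = N := by simpa using hNpos.isHermitian.eq
  have hNdet : IsUnit N.det := (isUnit_iff_isUnit_det N).1 hNpos.isUnit
  have hNA : N * Ared = Φᵀ * (M * A) * Φ := by
    rw [hAred, hΨ, transpose_mul, transpose_mul, transpose_nonsing_inv, hNT, hMT]
    simp only [Matrix.mul_assoc]
    rw [mul_nonsing_inv_cancel_left _ _ hNdet]
  have hAN : Aredᵀ * N = Φᵀ * (Aᵀ * M) * Φ := by
    have h := congrArg transpose hNA
    simpa [transpose_mul, hNT, hMT, Matrix.mul_assoc] using h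
  have hL : (-(Aredᵀ * N + N * Ared)).PosDef := by
    have h := hLyap.conjTranspose_mul_mul_same hinj
    rw [conjTranspose_eq_transpose_of_trivial] at h
    rwa [hNA, hAN, ← Matrix.add_mul, ← Matrix.mul_add, ← Matrix.neg_mul, ← Matrix.mul_neg]
  exact ⟨hL, .of_lyapunov hNpos hL⟩
end

section
/- Let A be a Hurwitz real n×n matrix and let Φ be any real n×k matrix of full column rank (k ≤ n). Then there exists a real n×k matrix Ψ such that Ψᵀ Φ = I_k and the reduced matrix Ã = Ψᵀ A Φ is Hurwitz. -/
open Matrix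

open scoped Matrix.Norms.L2Operator ComplexOrder

section ComplexMatrices

variable {m : Type*} [Fintype m] [DecidableEq m]

theorem Matrix.mem_spectrum_iff_exists_mulVec_eq_smul {K : Type*} [Field K]
    {A : Matrix m m K} {μ : K} :
    μ ∈ spectrum K A ↔ ∃ v ≠ 0, A *ᵥ v = μ • v := by
  rw [spectrum.mem_iff, Matrix.isUnit_iff_isUnit_det, isUnit_iff_ne_zero, not_not,
    ← Matrix.exists_mulVec_eq_zero_iff]
  simp only [Algebra.algebraMap_eq_smul_one, sub_mulVec, smul_mulVec, one_mulVec, sub_eq_zero,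
    eq_comm]

/-- The easy half of Lyapunov's theorem. -/
theorem Matrix.re_neg_of_mem_spectrum_of_lyapunov {A P : Matrix m m ℂ} (hP : P.PosDef)
    (hAP : (-(Aᴴ * P + P * A)).PosDef) {μ : ℂ} (hμ : μ ∈ spectrum ℂ A) : μ.re < 0 := by
  obtain ⟨v, hv, hAv⟩ := mem_spectrum_iff_exists_mulVec_eq_smul.1 hμ
  have hpos := hP.dotProduct_mulVec_pos hv
  have hneg := hAP.dotProduct_mulVec_pos hv
  have hleft : star v ⬝ᵥ ((Aᴴ * P) *ᵥ v) = star μ * (star v ⬝ᵥ (P *ᵥ v)) := by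
    rw [← mulVec_mulVec, dotProduct_mulVec, ← star_mulVec, hAv, star_smul, smul_dotProduct,
      smul_eq_mul]
  have hright : star v ⬝ᵥ ((P * A) *ᵥ v) = μ * (star v ⬝ᵥ (P *ᵥ v)) := by
    rw [← mulVec_mulVec, hAv, mulVec_smul, dotProduct_smul, smul_eq_mul]
  rw [neg_mulVec, add_mulVec, dotProduct_neg, dotProduct_add, hleft, hright] at hneg
  obtain ⟨hre, him⟩ := Complex.pos_iff.1 hpos
  have := (Complex.pos_iff.1 hneg).1
  simp [← him] at this
  nlinarith

theorem Matrix.exists_norm_pow_succ_lt_one {C : Matrix m m ℂ}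
    (hC : ∀ μ ∈ spectrum ℂ C, ‖μ‖ < 1) : ∃ N : ℕ, ‖C ^ (N + 1)‖ < 1 := by
  cases isEmpty_or_nonempty m
  · exact ⟨0, by simp [Subsingleton.elim C 0]⟩
  have hr : spectralRadius ℂ C < (1 : NNReal) :=
    spectrum.spectralRadius_lt_of_forall_lt C fun z hz => by exact_mod_cast hC z hz
  obtain ⟨N, hN, hN'⟩ := (((spectrum.pow_nnnorm_pow_one_div_tendsto_nhds_spectralRadius
    C).eventually_lt_const hr).and (Filter.eventually_ge_atTop 1)).exists
  obtain ⟨N, rfl⟩ := Nat.exists_eq_add_of_le' hN'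
  refine ⟨N, ?_⟩
  by_contra! h
  refine hN.not_ge ?_
  have : (1 : ENNReal) ≤ ‖C ^ (N + 1)‖₊ := by exact_mod_cast h
  simpa using ENNReal.one_le_rpow this (by positivity : (0 : ℝ) < 1 / ((N + 1 : ℕ) : ℝ))

omit [DecidableEq m] in
theorem Matrix.star_dotProduct_self_eq_norm_sq (x : m → ℂ) :
    star x ⬝ᵥ x = ((‖WithLp.toLp 2 x‖ ^ 2 : ℝ) : ℂ) := by
  rw [EuclideanSpace.norm_sq_eq]
  simp [dotProduct, Complex.conj_mul']

theorem Matrix.posDef_one_sub_conjTranspose_mul_self {D : Matrix m m ℂ} (hD : ‖D‖ < 1) :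
    (1 - Dᴴ * D).PosDef := by
  refine .of_dotProduct_mulVec_pos (isHermitian_one.sub (isHermitian_conjTranspose_mul_self D))
    fun x hx => ?_
  rw [sub_mulVec, one_mulVec, dotProduct_sub, ← mulVec_mulVec, dotProduct_mulVec (star x),
    ← star_mulVec, star_dotProduct_self_eq_norm_sq, star_dotProduct_self_eq_norm_sq,
    ← Complex.ofReal_sub]
  have hle : ‖WithLp.toLp 2 (D *ᵥ x)‖ ≤ ‖D‖ * ‖WithLp.toLp 2 x‖ :=
    l2_opNorm_mulVec D (WithLp.toLp 2 x)
  have hpos : 0 < ‖WithLp.toLp 2 x‖ := by simpa using hx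
  have hlt : ‖WithLp.toLp 2 (D *ᵥ x)‖ < ‖WithLp.toLp 2 x‖ := by nlinarith
  have := pow_lt_pow_left₀ hlt (norm_nonneg _) two_ne_zero
  exact_mod_cast sub_pos.2 this

/-- The spectrum of the Cayley transform of a matrix with spectrum in the open left half plane
lies in the open unit disc. -/
theorem Matrix.norm_lt_one_of_mem_spectrum_cayley {A : Matrix m m ℂ}
    (hA : ∀ μ ∈ spectrum ℂ A, μ.re < 0) (hM : IsUnit (A - 1)) {μ : ℂ}
    (hμ : μ ∈ spectrum ℂ ((A + 1) * (A - 1)⁻¹)) : ‖μ‖ < 1 := by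
  obtain ⟨v, hv, hCv⟩ := mem_spectrum_iff_exists_mulVec_eq_smul.1 hμ
  have hdet := (Matrix.isUnit_iff_isUnit_det _).1 hM
  set w := (A - 1)⁻¹ *ᵥ v with hw
  have hvw : v = (A - 1) *ᵥ w := by
    rw [hw, mulVec_mulVec, mul_nonsing_inv _ hdet, one_mulVec]
  have hw0 : w ≠ 0 := by
    rintro h
    rw [h, mulVec_zero] at hvw
    exact hv hvw
  rw [← mulVec_mulVec, ← hw, hvw] at hCv
  simp only [add_mulVec, sub_mulVec, one_mulVec] at hCv
  have hAw : (μ - 1) • (A *ᵥ w) = (μ + 1) • w := by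
    simp only [smul_sub] at hCv
    simp only [sub_smul, add_smul, one_smul]
    linear_combination -hCv
  have hμ1 : μ - 1 ≠ 0 := by
    intro h
    rw [h, zero_smul, sub_eq_zero.1 h] at hAw
    exact hw0 ((smul_eq_zero.1 hAw.symm).resolve_left (by norm_num))
  have hre := hA ((μ + 1) / (μ - 1)) <| mem_spectrum_iff_exists_mulVec_eq_smul.2
    ⟨w, hw0, by rw [div_eq_inv_mul, mul_smul, ← hAw, inv_smul_smul₀ hμ1]⟩
  have hns := Complex.normSq_pos.2 hμ1
  rw [Complex.div_re, ← add_div, div_lt_iff₀ hns, zero_mul] at hre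
  simp at hre
  rw [← sq_lt_one_iff₀ (norm_nonneg _), Complex.sq_norm, Complex.normSq_apply]
  linarith

/-- A solution of a Lyapunov inequality for a matrix with spectrum in the open left half plane, as
an explicit polynomial in the matrix and its adjoint. -/
theorem Matrix.exists_lyapunov_sum {A : Matrix m m ℂ}
    (hA : ∀ μ ∈ spectrum ℂ A, μ.re < 0) :
    ∃ N : ℕ, ∀ P : Matrix m m ℂ,
      P = ∑ j ∈ Finset.range (N + 1),
        ((A - 1) ^ (N - j) * (A + 1) ^ j)ᴴ * ((A - 1) ^ (N - j) * (A + 1) ^ j) →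
      P.PosDef ∧ (-(Aᴴ * P + P * A)).PosDef := by
  have hM : IsUnit (A - 1) := by
    have : (1 : ℂ) ∉ spectrum ℂ A := fun h => absurd (hA 1 h) (by norm_num)
    rw [spectrum.notMem_iff, map_one] at this
    simpa using this.neg
  obtain ⟨N, hN⟩ := exists_norm_pow_succ_lt_one
    fun μ hμ => norm_lt_one_of_mem_spectrum_cayley hA hM hμ
  refine ⟨N, fun P hP => ⟨?_, ?_⟩⟩
  · rw [hP, Finset.sum_range_succ', add_comm]
    refine PosDef.add_posSemidef ?_ (posSemidef_sum _ fun j _ =>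
      posSemidef_conjTranspose_mul_self _)
    simpa using PosDef.conjTranspose_mul_self ((A - 1) ^ N)
      (mulVec_injective_of_isUnit (hM.pow N))
  have hcomm : Commute (A + 1) (A - 1) := by
    simp only [Commute, SemiconjBy]; noncomm_ring
  have hdet := (Matrix.isUnit_iff_isUnit_det _).1 hM
  set M := A - 1 with hMdef
  set K := A + 1 with hKdef
  let f : ℕ → Matrix m m ℂ := fun j =>
    (M ^ (N + 1 - j) * K ^ j)ᴴ * (M ^ (N + 1 - j) * K ^ j)
  have htel : Mᴴ * P * M - Kᴴ * P * K = f 0 - f (N + 1) := by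
    rw [← Finset.sum_range_sub', hP, Finset.mul_sum, Finset.mul_sum, Finset.sum_mul,
      Finset.sum_mul, ← Finset.sum_sub_distrib]
    refine Finset.sum_congr rfl fun j hj => ?_
    have hj' : N + 1 - j = N - j + 1 := by have := Finset.mem_range.1 hj; omega
    have h1 : M ^ (N - j) * K ^ j * M = M ^ (N + 1 - j) * K ^ j := by
      rw [hj', pow_succ, mul_assoc, mul_assoc, (hcomm.pow_left j).eq]
    have h2 : M ^ (N - j) * K ^ j * K = M ^ (N + 1 - (j + 1)) * K ^ (j + 1) := by
      rw [Nat.add_sub_add_right, pow_succ, mul_assoc]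
    simp only [f]
    rw [← h1, ← h2]
    simp only [conjTranspose_mul, mul_assoc]
  have hCM : (K * M⁻¹) ^ (N + 1) * M ^ (N + 1) = K ^ (N + 1) := by
    have hc : Commute (K * M⁻¹) M := by
      rw [Commute, SemiconjBy, mul_assoc, nonsing_inv_mul _ hdet, ← mul_assoc, ← hcomm.eq,
        mul_assoc, mul_nonsing_inv _ hdet]
    rw [← hc.mul_pow, mul_assoc, nonsing_inv_mul _ hdet, mul_one]
  have hdiff : (f 0 - f (N + 1)).PosDef := by
    have := (posDef_one_sub_conjTranspose_mul_self hN).conjTranspose_mul_mul_same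
      (mulVec_injective_of_isUnit (hM.pow (N + 1)))
    convert! this using 1
    simp only [f, Nat.sub_zero, Nat.sub_self, pow_zero, mul_one, one_mul]
    rw [← hCM, conjTranspose_mul]
    noncomm_ring
  have htwo : Mᴴ * P * M - Kᴴ * P * K = (2 : ℝ) • -(Aᴴ * P + P * A) := by
    rw [hMdef, hKdef, conjTranspose_sub, conjTranspose_add, conjTranspose_one, two_smul]
    noncomm_ring
  rw [← htel, htwo] at hdiff
  have := hdiff.smul (show (0 : ℝ) < 1 / 2 by norm_num)
  rwa [smul_smul, one_div, inv_mul_cancel₀ two_ne_zero, one_smul] at this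

end ComplexMatrices

theorem Matrix.map_ofReal_conjTranspose {m n : Type*} (X : Matrix m n ℝ) :
    (X.map Complex.ofReal)ᴴ = Xᵀ.map Complex.ofReal := by
  ext; simp

theorem Matrix.map_ofReal_mul {l m n : Type*} [Fintype m] (X : Matrix l m ℝ) (Y : Matrix m n ℝ) :
    (X * Y).map Complex.ofReal = X.map Complex.ofReal * Y.map Complex.ofReal :=
  Matrix.map_mul (f := Complex.ofRealHom)

theorem IsHurwitz.exists_lyapunov {n : ℕ} {A : Matrix (Fin n) (Fin n) ℝ} (hA : IsHurwitz A) :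
    ∃ P : Matrix (Fin n) (Fin n) ℝ, (P.map Complex.ofReal).PosDef ∧
      (-((A.map Complex.ofReal)ᴴ * P.map Complex.ofReal +
        P.map Complex.ofReal * A.map Complex.ofReal)).PosDef := by
  obtain ⟨N, hN⟩ := Matrix.exists_lyapunov_sum hA
  refine ⟨∑ j ∈ Finset.range (N + 1),
    ((A - 1) ^ (N - j) * (A + 1) ^ j)ᵀ * ((A - 1) ^ (N - j) * (A + 1) ^ j), hN _ ?_⟩
  have hmap (X : Matrix (Fin n) (Fin n) ℝ) :
    X.map Complex.ofReal = Complex.ofRealHom.mapMatrix X := rfl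
  have hT (X : Matrix (Fin n) (Fin n) ℝ) :
    Complex.ofRealHom.mapMatrix Xᵀ = (Complex.ofRealHom.mapMatrix X)ᴴ :=
    (Matrix.map_ofReal_conjTranspose X).symm
  simp only [hmap, map_sum, map_mul, hT, map_pow, map_sub, map_add, map_one]

theorem Matrix.map_ofReal_mulVec_injective_of_rank_eq {n k : ℕ} {Φ : Matrix (Fin n) (Fin k) ℝ}
    (hΦ : Φ.rank = k) : Function.Injective (Φ.map Complex.ofReal).mulVec := by
  have hinj : Function.Injective Φ.mulVec := by
    rw [mulVec_injective_iff, linearIndependent_iff_card_eq_finrank_span, Set.finrank,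
      ← rank_eq_finrank_span_cols, hΦ, Fintype.card_fin]
  have hunit := (PosDef.conjTranspose_mul_self Φ hinj).isUnit
  rw [conjTranspose_eq_transpose_of_trivial, Matrix.isUnit_iff_isUnit_det] at hunit
  have hinv : ((Φᵀ * Φ)⁻¹ * Φᵀ).map Complex.ofReal * Φ.map Complex.ofReal = 1 := by
    rw [← map_ofReal_mul, Matrix.mul_assoc, nonsing_inv_mul _ hunit]
    exact map_one Complex.ofRealHom.mapMatrix
  refine Function.LeftInverse.injective
    (g := (((Φᵀ * Φ)⁻¹ * Φᵀ).map Complex.ofReal).mulVec) fun x => ?_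
  rw [mulVec_mulVec, hinv, one_mulVec]

theorem exists_left_basis_hurwitz_reduction
    {n k : ℕ} (hkn : k ≤ n) (A : Matrix (Fin n) (Fin n) ℝ)
    (hA : IsHurwitz A)
    (Φ : Matrix (Fin n) (Fin k) ℝ) (hΦ : Φ.rank = k) :
    ∃ Ψ : Matrix (Fin n) (Fin k) ℝ,
      Ψᵀ * Φ = 1 ∧ IsHurwitz (Ψᵀ * A * Φ) := by
  obtain ⟨P, hP, hAP⟩ := hA.exists_lyapunov
  have hinj := map_ofReal_mulVec_injective_of_rank_eq hΦ
  have hG := hP.conjTranspose_mul_mul_same hinj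
  have hred := hAP.conjTranspose_mul_mul_same hinj
  have hdet : IsUnit (Φᵀ * P * Φ).det := by
    have h := (Matrix.isUnit_iff_isUnit_det _).1 hG.isUnit
    rw [map_ofReal_conjTranspose, ← map_ofReal_mul, ← map_ofReal_mul] at h
    have hmap : ((Φᵀ * P * Φ).map Complex.ofReal).det = Complex.ofReal (Φᵀ * P * Φ).det :=
      (RingHom.map_det Complex.ofRealHom _).symm
    rw [hmap] at h
    simpa using h
  refine ⟨((Φᵀ * P * Φ)⁻¹ * (Φᵀ * P))ᵀ, ?_, fun μ hμ => ?_⟩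
  · rw [transpose_transpose, Matrix.mul_assoc, nonsing_inv_mul _ hdet]
  rw [transpose_transpose] at hμ
  refine re_neg_of_mem_spectrum_of_lyapunov hG ?_ hμ
  have hcancel : (Φ.map Complex.ofReal)ᴴ * P.map Complex.ofReal * Φ.map Complex.ofReal *
      ((Φᵀ * P * Φ)⁻¹ * (Φᵀ * P) * A * Φ).map Complex.ofReal =
      (Φ.map Complex.ofReal)ᴴ * P.map Complex.ofReal * A.map Complex.ofReal *
        Φ.map Complex.ofReal := by
    simp only [map_ofReal_conjTranspose, ← map_ofReal_mul]
    congr 1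
    rw [Matrix.mul_assoc _ A Φ, Matrix.mul_assoc _ (Φᵀ * P) (A * Φ),
      mul_nonsing_inv_cancel_left _ _ hdet, ← Matrix.mul_assoc]
  have hcancel' := congrArg conjTranspose hcancel
  rw [conjTranspose_mul, hG.isHermitian.eq] at hcancel'
  rw [hcancel, hcancel']
  convert! hred using 1
  simp only [conjTranspose_mul, conjTranspose_conjTranspose, hP.isHermitian.eq,
    Matrix.mul_neg, Matrix.neg_mul, Matrix.mul_add, Matrix.add_mul, Matrix.mul_assoc]
end
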